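/- arXiv:2602.21051 — 4 statements merged into one kernel-verified Lean document; each statement's English description precedes it below -/
import Mathlib

section
/- Let (A_1,…,A_d) be a row contraction of N×N complex matrices and let p(z) = det(I_N − Σ_{j=1}^d z_j A_j). Then there exist an integer m ≥ 0, points ζ_1, …, ζ_m on the unit sphere ∂𝔹_d (listed with multiplicity), and a polynomial q ∈ ℂ[z_1,…,z_d] with no zeros on the closed unit ball, such that p(z) = q(z) · Π_{i=1}^m (1 − ⟨z, ζ_i⟩), where ⟨z,ζ⟩ = Σ_{j=1}^d z_j·conj(ζ_j). In particular p has only finitely many zeros on ∂𝔹_d, namely the points ζ_1,…,ζ_m. -/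
open Matrix
open scoped ComplexOrder

/-- On the closed unit ball, a left fixed vector of `∑ z j • A j` forces `z` to lie on the sphere
and to be the joint eigenvalue of the adjoints. -/
lemma adjoint_eigenvector_of_vecMul_eq {N d : ℕ} {A : Fin d → Matrix (Fin N) (Fin N) ℂ}
    (hA : (1 - ∑ j, A j * (A j)ᴴ).PosSemidef) {z : Fin d → ℂ} (hz : (∑ j, ‖z j‖ ^ 2) ≤ 1)
    {w : Fin N → ℂ} (hw : w ≠ 0) (h : star w ᵥ* (∑ j, z j • A j) = star w) :
    (∑ j, ‖z j‖ ^ 2) = 1 ∧ ∀ j, star w ᵥ* A j = star (z j) • star w := by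
  set E : Fin d → Fin N → ℂ := fun j => star w ᵥ* A j - star (z j) • star w with hE
  have hpos : 0 < star w ⬝ᵥ w := dotProduct_star_self_pos_iff.mpr hw
  have key : ∑ j, E j ⬝ᵥ star (E j) ≤ (((∑ j, ‖z j‖ ^ 2) - 1 : ℝ) : ℂ) * (star w ⬝ᵥ w) := by
    have h1 : ∑ j, (star w ᵥ* A j) ⬝ᵥ ((A j)ᴴ *ᵥ w) ≤ star w ⬝ᵥ w := by
      have := hA.dotProduct_mulVec_nonneg w
      have e : ∀ j, star w ⬝ᵥ ((A j * (A j)ᴴ) *ᵥ w) = (star w ᵥ* A j) ⬝ᵥ ((A j)ᴴ *ᵥ w) :=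
        fun j => by rw [← mulVec_mulVec, dotProduct_mulVec]
      rw [sub_mulVec, one_mulVec, dotProduct_sub, sum_mulVec, dotProduct_sum, sub_nonneg] at this
      simpa only [e] using this
    have h2 : ∑ j, z j * ((star w ᵥ* A j) ⬝ᵥ w) = star w ⬝ᵥ w := by
      have := congrArg (fun u => u ⬝ᵥ w) h
      simpa [vecMul_sum, sum_dotProduct, vecMul_smul] using this
    have h3 : ∑ j, star (z j) * (star w ⬝ᵥ ((A j)ᴴ *ᵥ w)) = star w ⬝ᵥ w := by
      have e : ∀ j, star ((star w ᵥ* A j) ⬝ᵥ w) = star w ⬝ᵥ ((A j)ᴴ *ᵥ w) := fun j => by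
        rw [← star_dotProduct_star, star_vecMul, star_star]
      have e' : star (star w ⬝ᵥ w) = star w ⬝ᵥ w := by
        rw [← star_dotProduct_star, star_star]
      have := congrArg star h2
      simpa only [star_sum, star_mul', e, e'] using this
    have h4 : ∀ j, E j ⬝ᵥ star (E j) = (star w ᵥ* A j) ⬝ᵥ ((A j)ᴴ *ᵥ w)
        - z j * ((star w ᵥ* A j) ⬝ᵥ w) - star (z j) * (star w ⬝ᵥ ((A j)ᴴ *ᵥ w))
        + (‖z j‖ ^ 2 : ℝ) * (star w ⬝ᵥ w) := by
      intro j
      have : ((‖z j‖ ^ 2 : ℝ) : ℂ) = z j * star (z j) := by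
        simp [Complex.mul_conj, Complex.normSq_eq_norm_sq]
      rw [this]
      simp only [hE, star_sub, star_smul, star_star, star_vecMul, dotProduct_sub, sub_dotProduct,
        smul_dotProduct, dotProduct_smul, smul_eq_mul]
      ring
    simp only [h4, Finset.sum_add_distrib, Finset.sum_sub_distrib, h2, h3, ← Finset.sum_mul]
    push_cast
    linear_combination h1
  have hnn : ∀ j, 0 ≤ E j ⬝ᵥ star (E j) := fun j => dotProduct_self_star_nonneg _
  have hge : 0 ≤ (((∑ j, ‖z j‖ ^ 2) - 1 : ℝ) : ℂ) * (star w ⬝ᵥ w) :=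
    (Finset.sum_nonneg fun j _ => hnn j).trans key
  have hz1 : (∑ j, ‖z j‖ ^ 2) = 1 := by
    obtain ⟨r, hr, hrw⟩ := RCLike.pos_iff_exists_ofReal.mp hpos
    rw [RCLike.ofReal_eq_complex_ofReal] at hrw
    rw [← hrw, ← Complex.ofReal_mul, Complex.zero_le_real] at hge
    linarith [nonneg_of_mul_nonneg_left hge hr]
  refine ⟨hz1, fun j => ?_⟩
  rw [hz1] at key
  have h0 : ∑ j, E j ⬝ᵥ star (E j) = 0 :=
    le_antisymm (by simpa using key) (Finset.sum_nonneg fun j _ => hnn j)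
  have := (Finset.sum_eq_zero_iff_of_nonneg fun j _ => hnn j).mp h0 j (Finset.mem_univ j)
  exact sub_eq_zero.mp (dotProduct_self_star_eq_zero.mp this)

/-- Some scalar multiple of a nonzero vector is the first column of a unitary matrix. -/
lemma exists_unitary_col {n : ℕ} {w : Fin (n + 1) → ℂ} (hw : w ≠ 0) :
    ∃ U ∈ unitaryGroup (Fin (n + 1)) ℂ, ∃ c : ℂ, (fun i => U i 0) = c • w := by
  set x : EuclideanSpace ℂ (Fin (n + 1)) := WithLp.toLp 2 w with hx
  have hx0 : x ≠ 0 := by simpa [hx] using hw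
  have hu : ‖((‖x‖⁻¹ : ℝ) : ℂ) • x‖ = 1 := by
    rw [norm_smul]; simp [hx0]
  obtain ⟨b, hb⟩ := Orthonormal.exists_orthonormalBasis_extension_of_card_eq (𝕜 := ℂ)
    (E := EuclideanSpace ℂ (Fin (n + 1))) (ι := Fin (n + 1)) (by simp)
    (v := fun _ => ((‖x‖⁻¹ : ℝ) : ℂ) • x) (s := {0})
    (by
      refine ⟨fun i => hu, fun i j hij => ?_⟩
      exact absurd (Subsingleton.elim i j) hij)
  refine ⟨(EuclideanSpace.basisFun (Fin (n + 1)) ℂ).toBasis.toMatrix b.toBasis,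
    ?_, ((‖x‖⁻¹ : ℝ) : ℂ), ?_⟩
  · exact OrthonormalBasis.toMatrix_orthonormalBasis_mem_unitary _ _
  · ext i
    have := hb 0 rfl
    simp [Module.Basis.toMatrix_apply, this, hx]

/-- The compression of a row contraction to the complement of a joint left eigenvector. -/
lemma posSemidef_submatrix_succ {n d : ℕ} {A : Fin d → Matrix (Fin (n + 1)) (Fin (n + 1)) ℂ}
    (hA : (1 - ∑ j, A j * (A j)ᴴ).PosSemidef) :
    (1 - ∑ j, (A j).submatrix Fin.succ Fin.succ *
      ((A j).submatrix Fin.succ Fin.succ)ᴴ).PosSemidef := by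
  have h : (1 - ∑ j, (A j).submatrix Fin.succ Fin.succ * ((A j).submatrix Fin.succ Fin.succ)ᴴ)
      = (1 - ∑ j, A j * (A j)ᴴ).submatrix Fin.succ Fin.succ
        + ∑ j, vecMulVec (fun i : Fin n => A j i.succ 0) (star fun i : Fin n => A j i.succ 0) := by
    ext a b
    simp [Matrix.sum_apply, mul_apply, Fin.sum_univ_succ, Matrix.one_apply, vecMulVec_apply,
      Finset.sum_add_distrib]
    ring
  rw [h]
  exact (hA.submatrix _).add (posSemidef_sum _ fun j _ => posSemidef_vecMulVec_self_star _)

/-- The linear pencil determinant is a polynomial function. -/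
lemma exists_eval_eq_det {N d : ℕ} (A : Fin d → Matrix (Fin N) (Fin N) ℂ) :
    ∃ q : MvPolynomial (Fin d) ℂ, ∀ z, MvPolynomial.eval z q = (1 - ∑ j, z j • A j).det := by
  refine ⟨(1 - ∑ j, (MvPolynomial.X j : MvPolynomial (Fin d) ℂ) •
    (A j).map MvPolynomial.C).det, fun z => ?_⟩
  rw [RingHom.map_det]
  congr 1
  ext a b
  simp [Matrix.sum_apply, Matrix.one_apply, apply_ite]

/-- Conjugating by a unitary matrix preserves row contractions. -/
lemma posSemidef_unitary_conj {N d : ℕ} {A : Fin d → Matrix (Fin N) (Fin N) ℂ}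
    (hA : (1 - ∑ j, A j * (A j)ᴴ).PosSemidef) {U : Matrix (Fin N) (Fin N) ℂ}
    (hU : U ∈ unitaryGroup (Fin N) ℂ) :
    (1 - ∑ j, (Uᴴ * A j * U) * (Uᴴ * A j * U)ᴴ).PosSemidef := by
  have hUU : Uᴴ * U = 1 := mem_unitaryGroup_iff'.mp hU
  have hUU' : U * Uᴴ = 1 := mem_unitaryGroup_iff.mp hU
  have h : ∀ j, (Uᴴ * A j * U) * (Uᴴ * A j * U)ᴴ = Uᴴ * (A j * (A j)ᴴ) * U := fun j => by
    calc _ = Uᴴ * A j * (U * Uᴴ) * (A j)ᴴ * U := by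
          simp only [conjTranspose_mul, conjTranspose_conjTranspose, mul_assoc]
      _ = _ := by rw [hUU', mul_one, mul_assoc Uᴴ]
  have := hA.conjTranspose_mul_mul_same U
  simpa only [h, mul_sub, sub_mul, mul_one, hUU, Finset.mul_sum, Finset.sum_mul] using this

/-- Conjugating by a unitary matrix preserves the determinant of the linear pencil. -/
lemma det_one_sub_sum_unitary_conj {N d : ℕ} (A : Fin d → Matrix (Fin N) (Fin N) ℂ)
    {U : Matrix (Fin N) (Fin N) ℂ} (hU : U ∈ unitaryGroup (Fin N) ℂ) (z : Fin d → ℂ) :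
    (1 - ∑ j, z j • (Uᴴ * A j * U)).det = (1 - ∑ j, z j • A j).det := by
  have hUU : Uᴴ * U = 1 := mem_unitaryGroup_iff'.mp hU
  have h : 1 - ∑ j, z j • (Uᴴ * A j * U) = Uᴴ * (1 - ∑ j, z j • A j) * U := by
    simp only [mul_sub, sub_mul, mul_one, hUU, Finset.mul_sum, Finset.sum_mul,
      Matrix.mul_smul, Matrix.smul_mul]
  rw [h, det_mul_right_comm, hUU, one_mul]

/-- A common first row `(μ j, 0, …, 0)` splits off a linear factor of the pencil determinant. -/
lemma det_one_sub_sum_of_row_zero {n d : ℕ} {B : Fin d → Matrix (Fin (n + 1)) (Fin (n + 1)) ℂ}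
    {μ : Fin d → ℂ} (hB : ∀ j, B j 0 = μ j • (1 : Matrix (Fin (n + 1)) (Fin (n + 1)) ℂ) 0)
    (z : Fin d → ℂ) :
    (1 - ∑ j, z j • B j).det =
      (1 - ∑ j, z j * μ j) * (1 - ∑ j, z j • (B j).submatrix Fin.succ Fin.succ).det := by
  have hsub : (1 - ∑ j, z j • B j).submatrix Fin.succ Fin.succ
      = 1 - ∑ j, z j • (B j).submatrix Fin.succ Fin.succ := by
    ext a b
    simp [Matrix.sum_apply, Matrix.one_apply]
  rw [det_succ_row_zero, Fin.sum_univ_succ, ← hsub]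
  simp [Matrix.sum_apply, hB, (Fin.succ_ne_zero _).symm]

/-- The factorization of the pencil determinant of a row contraction. -/
lemma exists_det_factorization {d : ℕ} (N : ℕ) (A : Fin d → Matrix (Fin N) (Fin N) ℂ)
    (hA : (1 - ∑ j, A j * (A j)ᴴ).PosSemidef) :
    ∃ (m : ℕ) (ζ : Fin m → (Fin d → ℂ)) (q : MvPolynomial (Fin d) ℂ),
      (∀ i, (∑ j, ‖ζ i j‖ ^ 2) = 1) ∧
      (∀ z : Fin d → ℂ, (∑ j, ‖z j‖ ^ 2) ≤ 1 → MvPolynomial.eval z q ≠ 0) ∧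
      (∀ z : Fin d → ℂ,
        (1 - ∑ j, z j • A j).det =
          MvPolynomial.eval z q * ∏ i, (1 - ∑ j, z j * (starRingEnd ℂ) (ζ i j))) := by
  induction N with
  | zero => exact ⟨0, Fin.elim0, 1, fun i => i.elim0, by simp, by simp⟩
  | succ n ih =>
    by_cases hzero : ∃ z : Fin d → ℂ, (∑ j, ‖z j‖ ^ 2) ≤ 1 ∧ (1 - ∑ j, z j • A j).det = 0
    · obtain ⟨ζ, hζ, hdet⟩ := hzero
      obtain ⟨v, hv, hvA⟩ := exists_vecMul_eq_zero_iff.mpr hdet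
      obtain ⟨w, rfl⟩ : ∃ w, v = star w := ⟨star v, (star_star v).symm⟩
      have hw : w ≠ 0 := by simpa using hv
      rw [vecMul_sub, vecMul_one, sub_eq_zero] at hvA
      obtain ⟨hζ1, hwA⟩ := adjoint_eigenvector_of_vecMul_eq hA hζ hw hvA.symm
      obtain ⟨U, hU, c, hc⟩ := exists_unitary_col hw
      have hrow : ∀ M : Matrix (Fin (n + 1)) (Fin (n + 1)) ℂ,
          (Uᴴ * M) 0 = star c • (star w ᵥ* M) := fun M => by
        rw [mul_apply_eq_vecMul, ← smul_vecMul, ← star_smul, ← hc]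
        rfl
      have hB : ∀ j, (Uᴴ * A j * U) 0
          = star (ζ j) • (1 : Matrix (Fin (n + 1)) (Fin (n + 1)) ℂ) 0 := fun j => by
        rw [← show Uᴴ * U = 1 from mem_unitaryGroup_iff'.mp hU, mul_assoc, hrow, hrow,
          ← vecMul_vecMul, hwA, smul_vecMul, smul_comm]
      obtain ⟨m, ξ, q, h1, h2, h3⟩ := ih (fun j => (Uᴴ * A j * U).submatrix Fin.succ Fin.succ)
        (posSemidef_submatrix_succ (posSemidef_unitary_conj hA hU))
      refine ⟨m + 1, Fin.cons ζ ξ, q, Fin.cases hζ1 h1, h2, fun z => ?_⟩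
      rw [← det_one_sub_sum_unitary_conj A hU, det_one_sub_sum_of_row_zero hB, h3,
        Fin.prod_univ_succ]
      simp only [Fin.cons_zero, Fin.cons_succ, starRingEnd_apply]
      ring
    · push Not at hzero
      obtain ⟨q, hq⟩ := exists_eval_eq_det A
      exact ⟨0, Fin.elim0, q, fun i => i.elim0, fun z hz => hq z ▸ hzero z hz, by simp [hq]⟩

/-- Equality case of the Cauchy–Schwarz inequality on the unit sphere. -/
lemma one_sub_sum_mul_conj_eq_zero_iff {d : ℕ} {z ζ : Fin d → ℂ} (hz : (∑ j, ‖z j‖ ^ 2) = 1)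
    (hζ : (∑ j, ‖ζ j‖ ^ 2) = 1) :
    1 - ∑ j, z j * (starRingEnd ℂ) (ζ j) = 0 ↔ z = ζ := by
  have hx : ‖(WithLp.toLp 2 z : EuclideanSpace ℂ (Fin d))‖ = 1 := by
    simp [EuclideanSpace.norm_eq, hz]
  have hy : ‖(WithLp.toLp 2 ζ : EuclideanSpace ℂ (Fin d))‖ = 1 := by
    simp [EuclideanSpace.norm_eq, hζ]
  have := inner_eq_one_iff_of_norm_eq_one (𝕜 := ℂ) hy hx
  rw [sub_eq_zero, eq_comm]
  simpa [PiLp.inner_apply, eq_comm] using this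

/-- If `(A_1,…,A_d)` is a row contraction of `N×N` complex matrices,
then the polynomial `p(z) = det(I − ∑ z_j A_j)` factors as
`p(z) = q(z)·∏_{i=1}^m (1 − ⟨z, ζ_i⟩)` where the `ζ_i` lie on the unit sphere
(with multiplicity) and `q` is a polynomial with no zeros on the closed unit ball;
in particular the zeros of `p` on the sphere are exactly the points `ζ_i`. -/
theorem statement16 (N d : ℕ) (hN : 0 < N) (hd : 0 < d)
    (A : Fin d → Matrix (Fin N) (Fin N) ℂ)
    (hA : (1 - ∑ j, A j * (A j)ᴴ).PosSemidef) :
    ∃ (m : ℕ) (ζ : Fin m → (Fin d → ℂ)) (q : MvPolynomial (Fin d) ℂ),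
      (∀ i, (∑ j, ‖ζ i j‖ ^ 2) = 1) ∧
      (∀ z : Fin d → ℂ, (∑ j, ‖z j‖ ^ 2) ≤ 1 → MvPolynomial.eval z q ≠ 0) ∧
      (∀ z : Fin d → ℂ,
        (1 - ∑ j, z j • A j).det =
          MvPolynomial.eval z q * ∏ i, (1 - ∑ j, z j * (starRingEnd ℂ) (ζ i j))) ∧
      (∀ z : Fin d → ℂ, (∑ j, ‖z j‖ ^ 2) = 1 →
        ((1 - ∑ j, z j • A j).det = 0 ↔ ∃ i, z = ζ i)) := by
  obtain ⟨m, ζ, q, h1, h2, h3⟩ := exists_det_factorization N A hA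
  refine ⟨m, ζ, q, h1, h2, h3, fun z hz => ?_⟩
  rw [h3, mul_eq_zero, or_iff_right (h2 z hz.le), Finset.prod_eq_zero_iff]
  simp [one_sub_sum_mul_conj_eq_zero_iff hz (h1 _)]
end

section
/- Let σ ∈ ℂ be a root of unity (σ^n = 1 for some positive integer n) and let A ∈ ℂ with A ≠ 0. Suppose Re(A σ^k) ≥ 0 for every integer k. Then either σ = −1 and Re A = 0, or σ = 1 and Re A ≥ 0. -/
/-- If the powers of a nontrivial root of unity, multiplied by `A`, all have nonnegative real part,
then these real parts vanish. -/
theorem re_mul_pow_eq_zero_of_nonneg {σ A : ℂ} {n : ℕ} (hn : σ ^ n = 1) (h1 : σ ≠ 1)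
    (h : ∀ k : ℕ, 0 ≤ (A * σ ^ k).re) {k : ℕ} (hk : k < n) : (A * σ ^ k).re = 0 := by
  have hgeom : ∑ i ∈ Finset.range n, σ ^ i = 0 := by
    rw [geom_sum_eq h1, hn, sub_self, zero_div]
  have hsum : ∑ i ∈ Finset.range n, (A * σ ^ i).re = 0 := by
    rw [← Complex.re_sum, ← Finset.mul_sum, hgeom, mul_zero, Complex.zero_re]
  exact (Finset.sum_eq_zero_iff_of_nonneg fun i _ => h i).mp hsum k (Finset.mem_range.mpr hk)


/-- If `σ ∈ ℂ` is a root of unity, `A ∈ ℂ` is nonzero, and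
`Re(A σ^k) ≥ 0` for every integer `k`, then either `σ = −1` and `Re A = 0`,
or `σ = 1` and `Re A ≥ 0`. -/
theorem statement17 (σ A : ℂ) (hσ : ∃ n : ℕ, 0 < n ∧ σ ^ n = 1) (hA : A ≠ 0)
    (h : ∀ k : ℤ, 0 ≤ (A * σ ^ k).re) :
    (σ = -1 ∧ A.re = 0) ∨ (σ = 1 ∧ 0 ≤ A.re) := by
  obtain ⟨n, hn, hpow⟩ := hσ
  by_cases h1 : σ = 1
  · exact Or.inr ⟨h1, by simpa using h 0⟩
  have hn1 : 1 < n := by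
    by_contra! hle
    obtain rfl : n = 1 := by omega
    exact h1 (by simpa using hpow)
  have hnonneg : ∀ k : ℕ, 0 ≤ (A * σ ^ k).re := fun k => by simpa using h k
  have hre : A.re = 0 := by
    simpa using re_mul_pow_eq_zero_of_nonneg hpow h1 hnonneg hn
  have him : A.im ≠ 0 := fun h0 => hA (Complex.ext hre h0)
  have hσim : σ.im = 0 := by
    have := re_mul_pow_eq_zero_of_nonneg hpow h1 hnonneg hn1
    simpa [Complex.mul_re, hre, him] using this
  have hnorm : |σ.re| = 1 := by
    rw [Complex.abs_re_eq_norm.mpr hσim]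
    exact Complex.norm_eq_one_of_pow_eq_one hpow hn.ne'
  rcases eq_or_eq_neg_of_abs_eq hnorm with hr | hr
  · exact absurd (Complex.ext hr hσim) h1
  · exact Or.inl ⟨Complex.ext (by simpa using hr) (by simpa using hσim), hre⟩
end

section
/- Let M be a positive integer and let L be a complex-analytic function on a neighborhood of 0 ∈ ℂ with L(0) = 0. Define the curve γ(s) = (s^M e^{M L(s)}, i s^{2M} + 2Mi ∫_{[0,s]} x^{2M} L′(x) dx), the integral taken along the straight segment from 0 to s. Suppose there exists a nonconstant irreducible polynomial p ∈ ℂ[z,w] such that p(γ(s)) = 0 for all s in a neighborhood of 0. Then the function f(s) = e^{L(s)} is algebraic: there exists a nonzero polynomial P ∈ ℂ[s,y] such that P(s, e^{L(s)}) = 0 for all s in a neighborhood of 0. -/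
/-- `gM M L s = i s^{2M} + 2Mi ∫_{[0,s]} x^{2M} L′(x) dx`, where the integral over
the straight segment from `0` to `s` is realized as `∫_{t ∈ [0,1]} (ts)^{2M} L′(ts) · s dt`. -/
noncomputable def curveWM (M : ℕ) (L : ℂ → ℂ) (s : ℂ) : ℂ :=
  Complex.I * s ^ (2 * M) +
    2 * (M : ℂ) * Complex.I *
      ∫ t in (0 : ℝ)..1, s * (((t : ℂ) * s) ^ (2 * M) * deriv L ((t : ℂ) * s))

open Polynomial Filter Topology Algebra

section AlgebraicDependence

variable {k A : Type*} [Field k] [CommRing A] [Algebra k A]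

theorem aevalAeval_mem_adjoin_pair (z w : A) (q : k[X][X]) :
    aevalAeval z w q ∈ adjoin k {z, w} := by
  have hz : z ∈ adjoin k {z, w} := subset_adjoin (by simp)
  have hw : w ∈ adjoin k {z, w} := subset_adjoin (by simp)
  have := (aevalAeval (R := k) (⟨z, hz⟩ : adjoin k {z, w}) ⟨w, hw⟩ q).2
  have h : (adjoin k {z, w}).val.comp
      (aevalAeval (R := k) (⟨z, hz⟩ : adjoin k {z, w}) ⟨w, hw⟩) = aevalAeval z w := by
    ext <;> simp
  rw [← h]
  exact this

theorem isAlgebraic_adjoin_singleton_of_aevalAeval_eq_zero {z w : A} (hz : Transcendental k z)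
    {q : k[X][X]} (hq : q ≠ 0) (h : aevalAeval z w q = 0) : IsAlgebraic (adjoin k {z}) w := by
  let e : k[X] →ₐ[k] adjoin k {z} := aeval ⟨z, self_mem_adjoin_singleton k z⟩
  have he : ∀ c, (e c : A) = aeval z c := fun c => by
    simp [e]
  have hinj : Function.Injective e := fun a b hab =>
    transcendental_iff_injective.1 hz (by rw [← he, ← he, hab])
  refine ⟨q.map e.toRingHom, (Polynomial.map_ne_zero_iff hinj).2 hq, ?_⟩
  have hcomp : ((aeval (R := adjoin k {z}) w).restrictScalars k).comp (mapAlgHom e) =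
      aevalAeval z w := by
    ext <;> simp [he]
  rw [← h, ← hcomp]
  rfl

theorem exists_aevalAeval_eq_zero_of_not_algebraicIndependent {z w : A}
    (h : ¬ AlgebraicIndependent k ![z, w]) : ∃ q : k[X][X], q ≠ 0 ∧ aevalAeval z w q = 0 := by
  rw [algebraicIndependent_iff] at h
  push Not at h
  obtain ⟨p, hp, hp0⟩ := h
  refine ⟨(Bivariate.equivMvPolynomial k).symm p, by simpa using hp0, ?_⟩
  have hcomp : (aevalAeval z w).comp
      ((Bivariate.equivMvPolynomial k).symm : MvPolynomial (Fin 2) k →ₐ[k] k[X][X]) =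
      MvPolynomial.aeval ![z, w] := by
    ext i
    fin_cases i <;> simp
  rw [← hp, ← hcomp]
  rfl

theorem exists_aevalAeval_eq_zero_derivative_ne_zero [CharZero k] {z w : A}
    (hz : Transcendental k z) (h : ∃ q : k[X][X], q ≠ 0 ∧ aevalAeval z w q = 0) :
    ∃ q : k[X][X], q ≠ 0 ∧ aevalAeval z w q = 0 ∧ aevalAeval z w (derivative q) ≠ 0 := by
  classical
  have hex : ∃ n, ∃ q : k[X][X], q ≠ 0 ∧ aevalAeval z w q = 0 ∧ q.natDegree = n :=
    let ⟨q, h1, h2⟩ := h; ⟨_, q, h1, h2, rfl⟩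
  obtain ⟨q, hq, hq0, hn⟩ := Nat.find_spec hex
  refine ⟨q, hq, hq0, fun hd => ?_⟩
  have hdeg : q.natDegree ≠ 0 := fun h0 => by
    rw [eq_C_of_natDegree_eq_zero h0] at hq hq0
    rw [aevalAeval_C] at hq0
    exact hq (by rw [transcendental_iff.1 hz _ hq0, C_0])
  refine Nat.find_min hex (m := (derivative q).natDegree) ?_
    ⟨derivative q, fun h0 => hdeg (derivative_eq_zero.1 h0), hd, rfl⟩
  rw [← hn]
  exact natDegree_derivative_lt hdeg

theorem isAlgebraic_adjoin_singleton_exchange [IsDomain A] {x z : A} (hx : Transcendental k x)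
    (h : IsAlgebraic (adjoin k {z}) x) : IsAlgebraic (adjoin k {x}) z := by
  have key : ∀ (s : Set A) (a : A), a ∈ (AlgebraicIndependent.matroid k A).closure s ↔
      IsAlgebraic (adjoin k s) a := fun s a => by
    rw [AlgebraicIndependent.matroid_closure_eq]; rfl
  have hempty : x ∉ (AlgebraicIndependent.matroid k A).closure ∅ := by
    rw [key]
    intro h'
    rw [adjoin_empty] at h'
    apply hx
    exact Subalgebra.isAlgebraic_of_isAlgebraic_bot h'
  have := (AlgebraicIndependent.matroid k A).closure_exchange (X := ∅) (e := x) (f := z)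
    ⟨by simpa [key] using h, hempty⟩
  simpa [key] using this.1

theorem not_algebraicIndependent_of_isAlgebraic_adjoin_singleton {x f : A}
    (h : IsAlgebraic (adjoin k {x}) f) : ¬ AlgebraicIndependent k ![x, f] := fun hind => by
  have := hind.transcendental_adjoin (s := {0}) (i := 1) (by simp)
  rw [Set.image_singleton] at this
  exact this h

variable [IsDomain A]

/-- If `x ^ N` is a quotient of polynomial expressions in `z` and `w`, where `w` is algebraic
over `k[z]`, and `z = x ^ m * f ^ n`, then `x` and `f` are algebraically dependent. -/
theorem not_algebraicIndependent_of_mul_pow_eq {x f z w a b : A} {N m n : ℕ} (hN : 0 < N)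
    (hn : 0 < n) (hx : Transcendental k x) (hw : IsAlgebraic (adjoin k {z}) w)
    (ha : a ∈ adjoin k {z, w}) (hb : b ∈ adjoin k {z, w}) (ha0 : a ≠ 0) (hab : a * x ^ N = b)
    (hf : x ^ m * f ^ n = z) : ¬ AlgebraicIndependent k ![x, f] := by
  have hz : IsAlgebraic (adjoin k {z}) z :=
    isAlgebraic_algebraMap (⟨z, self_mem_adjoin_singleton k z⟩ : adjoin k {z})
  have hle : ∀ c ∈ adjoin k {z, w}, IsAlgebraic (adjoin k {z}) c := fun c hc => by
    have : adjoin k {z, w} ≤ (Subalgebra.algebraicClosure (adjoin k {z}) A).restrictScalars k :=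
      adjoin_le (by rintro _ (rfl | rfl) <;> assumption)
    exact this hc
  have hxz : IsAlgebraic (adjoin k {z}) x := by
    refine IsAlgebraic.of_pow hN ?_
    refine IsAlgebraic.of_mul (mem_nonZeroDivisors_of_ne_zero ha0) (hle a ha) ?_
    rw [hab]
    exact hle b hb
  have hzx := isAlgebraic_adjoin_singleton_exchange hx hxz
  apply not_algebraicIndependent_of_isAlgebraic_adjoin_singleton
  have hxx : IsAlgebraic (adjoin k {x}) x :=
    isAlgebraic_algebraMap (⟨x, self_mem_adjoin_singleton k x⟩ : adjoin k {x})
  have hx0 : x ≠ 0 := fun h => hx (h ▸ isAlgebraic_zero)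
  refine IsAlgebraic.of_pow hn ?_
  refine IsAlgebraic.of_mul (mem_nonZeroDivisors_of_ne_zero (pow_ne_zero m hx0)) (hxx.pow m) ?_
  rwa [hf]

/-- Suppose every polynomial relation `q(z, w) = 0` yields `r(z, w) + c q_w(z, w) x ^ N = 0` for
some `r` and a nonzero constant `c`. If `z` and `w` are algebraically dependent, and
`z = x ^ m * f ^ n`, then `x` and `f` are algebraically dependent. -/
theorem not_algebraicIndependent_of_forall_relation [CharZero k] {x f z w : A} {N m n : ℕ}
    (hN : 0 < N) (hn : 0 < n) {c : k} (hc : c ≠ 0) (hx : Transcendental k x)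
    (hz : Transcendental k z) (hzw : ¬ AlgebraicIndependent k ![z, w])
    (hrel : ∀ q : k[X][X], aevalAeval z w q = 0 → ∃ r : k[X][X],
      aevalAeval z w r + aevalAeval z w (C (C c) * derivative q) * x ^ N = 0)
    (hf : x ^ m * f ^ n = z) : ¬ AlgebraicIndependent k ![x, f] := by
  obtain ⟨q, hq, hq0, hqd⟩ := exists_aevalAeval_eq_zero_derivative_ne_zero hz
    (exists_aevalAeval_eq_zero_of_not_algebraicIndependent hzw)
  obtain ⟨r, hr⟩ := hrel q hq0
  refine not_algebraicIndependent_of_mul_pow_eq hN hn hx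
    (isAlgebraic_adjoin_singleton_of_aevalAeval_eq_zero hz hq hq0)
    (aevalAeval_mem_adjoin_pair z w (C (C c) * derivative q))
    (aevalAeval_mem_adjoin_pair _ _ _) ?_
    (b := aevalAeval z w (-r)) (by rw [map_neg, eq_neg_iff_add_eq_zero, add_comm, hr]) hf
  rw [map_mul]
  refine mul_ne_zero ?_ hqd
  rw [aevalAeval_C, aeval_C]
  exact (map_ne_zero_iff _ (algebraMap k A).injective).2 hc

end AlgebraicDependence

section AnalyticGerm

/-- The algebra of functions analytic at `z₀`. -/
def analyticAtSubalgebra (z₀ : ℂ) : Subalgebra ℂ (ℂ → ℂ) where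
  carrier := {f | AnalyticAt ℂ f z₀}
  mul_mem' hf hg := AnalyticAt.mul hf hg
  add_mem' hf hg := AnalyticAt.add hf hg
  algebraMap_mem' _ := analyticAt_const

/-- The ideal of functions vanishing near `z₀`. -/
def eventuallyZeroIdeal (z₀ : ℂ) : Ideal (analyticAtSubalgebra z₀) where
  carrier := {f | ∀ᶠ s in 𝓝 z₀, f.1 s = 0}
  add_mem' hf hg := by
    filter_upwards [hf, hg] with s h1 h2
    simp [h1, h2]
  zero_mem' := by simp
  smul_mem' c f hf := by
    filter_upwards [hf] with s h1
    simp [h1]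

/-- The ring of germs at `z₀` of analytic functions. -/
abbrev AnalyticGerm (z₀ : ℂ) := analyticAtSubalgebra z₀ ⧸ eventuallyZeroIdeal z₀

variable {z₀ : ℂ}

instance : (eventuallyZeroIdeal z₀).IsPrime where
  ne_top' := by
    rw [Ideal.ne_top_iff_one]
    intro h
    have : (1 : ℂ) = 0 := Eventually.self_of_nhds (x := z₀) h
    exact one_ne_zero this
  mem_or_mem' := by
    intro f g h
    rcases f.2.eventually_eq_zero_or_eventually_ne_zero with hf | hf
    · exact Or.inl hf
    rcases g.2.eventually_eq_zero_or_eventually_ne_zero with hg | hg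
    · exact Or.inr hg
    have h' : ∀ᶠ s in 𝓝[≠] z₀, f.1 s * g.1 s = 0 := h.filter_mono nhdsWithin_le_nhds
    obtain ⟨s, h1, h2, h3⟩ := (hf.and (hg.and h')).exists
    exact absurd h3 (mul_ne_zero h1 h2)

/-- The germ at `z₀` of an analytic function. -/
def AnalyticGerm.of {f : ℂ → ℂ} (hf : AnalyticAt ℂ f z₀) : AnalyticGerm z₀ :=
  Ideal.Quotient.mkₐ ℂ (eventuallyZeroIdeal z₀) ⟨f, hf⟩

namespace AnalyticGerm

theorem of_eq_of_iff {f g : ℂ → ℂ} {hf : AnalyticAt ℂ f z₀} {hg : AnalyticAt ℂ g z₀} :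
    of hf = of hg ↔ f =ᶠ[𝓝 z₀] g := by
  simp only [of, Ideal.Quotient.mkₐ_eq_mk, Ideal.Quotient.eq]
  change (∀ᶠ s in 𝓝 z₀, f s - g s = 0) ↔ _
  simp only [sub_eq_zero]
  rfl

theorem of_eq_zero_iff {f : ℂ → ℂ} {hf : AnalyticAt ℂ f z₀} :
    of hf = 0 ↔ ∀ᶠ s in 𝓝 z₀, f s = 0 := by
  rw [of, Ideal.Quotient.mkₐ_eq_mk, Ideal.Quotient.eq_zero_iff_mem]
  rfl

theorem coe_aevalAeval_analyticAtSubalgebra (F G : analyticAtSubalgebra z₀) (q : ℂ[X][X]) :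
    (aevalAeval F G q : ℂ → ℂ) = fun s => q.evalEval (F.1 s) (G.1 s) := by
  funext s
  have h : ((Pi.evalAlgHom ℂ (fun _ : ℂ => ℂ) s).comp (analyticAtSubalgebra z₀).val).comp
      (aevalAeval F G) = aevalAeval (F.1 s) (G.1 s) := by
    ext <;> simp
  rw [← coe_aevalAeval_eq_evalEval, ← h]
  rfl

theorem analyticAt_evalEval {f g : ℂ → ℂ} (hf : AnalyticAt ℂ f z₀) (hg : AnalyticAt ℂ g z₀)
    (q : ℂ[X][X]) : AnalyticAt ℂ (fun s => q.evalEval (f s) (g s)) z₀ :=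
  coe_aevalAeval_analyticAtSubalgebra ⟨f, hf⟩ ⟨g, hg⟩ q ▸
    (aevalAeval (⟨f, hf⟩ : analyticAtSubalgebra z₀) ⟨g, hg⟩ q).2

theorem aevalAeval_of {f g : ℂ → ℂ} (hf : AnalyticAt ℂ f z₀) (hg : AnalyticAt ℂ g z₀)
    (q : ℂ[X][X]) : aevalAeval (of hf) (of hg) q = of (analyticAt_evalEval hf hg q) := by
  have h : (Ideal.Quotient.mkₐ ℂ (eventuallyZeroIdeal z₀)).comp
      (aevalAeval ⟨f, hf⟩ ⟨g, hg⟩) = aevalAeval (of hf) (of hg) := by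
    ext <;> simp [of]
  rw [← h, AlgHom.comp_apply, of]
  exact congrArg _ (Subtype.ext (coe_aevalAeval_analyticAtSubalgebra _ _ q))

theorem of_add {f g : ℂ → ℂ} (hf : AnalyticAt ℂ f z₀) (hg : AnalyticAt ℂ g z₀) :
    of hf + of hg = of (hf.add hg) := rfl

theorem of_mul {f g : ℂ → ℂ} (hf : AnalyticAt ℂ f z₀) (hg : AnalyticAt ℂ g z₀) :
    of hf * of hg = of (hf.mul hg) := rfl

theorem of_pow {f : ℂ → ℂ} (hf : AnalyticAt ℂ f z₀) (n : ℕ) :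
    of hf ^ n = of (hf.pow n) := rfl

theorem aeval_of_eq_zero_iff {f g : ℂ → ℂ} (hf : AnalyticAt ℂ f z₀)
    (hg : AnalyticAt ℂ g z₀) (P : MvPolynomial (Fin 2) ℂ) :
    MvPolynomial.aeval ![of hf, of hg] P = 0 ↔
      ∀ᶠ s in 𝓝 z₀, MvPolynomial.eval ![f s, g s] P = 0 := by
  let F : analyticAtSubalgebra z₀ := ⟨f, hf⟩
  let G : analyticAtSubalgebra z₀ := ⟨g, hg⟩
  have h1 : (Ideal.Quotient.mkₐ ℂ (eventuallyZeroIdeal z₀)).comp (MvPolynomial.aeval ![F, G]) =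
      MvPolynomial.aeval ![of hf, of hg] := by
    ext i; fin_cases i <;> simp [F, G, of]
  have h2 (s : ℂ) : ((Pi.evalAlgHom ℂ (fun _ : ℂ => ℂ) s).comp (analyticAtSubalgebra z₀).val).comp
      (MvPolynomial.aeval ![F, G]) = MvPolynomial.aeval ![f s, g s] := by
    ext i; fin_cases i <;> simp [F, G]
  rw [← h1, AlgHom.comp_apply, Ideal.Quotient.mkₐ_eq_mk, Ideal.Quotient.eq_zero_iff_mem]
  refine eventually_congr (Eventually.of_forall fun s => ?_)
  rw [← MvPolynomial.coe_aeval_eq_eval, RingHom.coe_coe, ← h2]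
  rfl

theorem transcendental_of {f : ℂ → ℂ} (hf : AnalyticAt ℂ f z₀) (h : ¬ ∀ᶠ s in 𝓝 z₀, f s = f z₀) :
    Transcendental ℂ (of hf) := by
  intro halg
  obtain ⟨c, hc⟩ : ∃ c : ℂ, algebraMap ℂ (AnalyticGerm z₀) c = of hf := by
    obtain ⟨c, hc⟩ := (IsAlgClosed.algebraMap_bijective_of_isIntegral (k := ℂ)
      (K := integralClosure ℂ (AnalyticGerm z₀))).2 ⟨of hf, halg.isIntegral⟩
    exact ⟨c, congrArg Subtype.val hc⟩
  have : algebraMap ℂ (AnalyticGerm z₀) c = of (analyticAt_const (v := c)) := rfl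
  rw [this, of_eq_of_iff] at hc
  apply h
  filter_upwards [hc] with s hs
  rw [← hs, ← hc.self_of_nhds]

end AnalyticGerm

end AnalyticGerm

/-- Chain rule for a bivariate polynomial evaluated along a curve. -/
theorem exists_hasDerivAt_evalEval {𝕜 : Type*} [NontriviallyNormedField 𝕜] (q : 𝕜[X][X]) :
    ∃ r : 𝕜[X][X], ∀ (Z W : 𝕜 → 𝕜) (Z' W' s : 𝕜), HasDerivAt Z Z' s → HasDerivAt W W' s →
      HasDerivAt (fun t => q.evalEval (Z t) (W t))
        (r.evalEval (Z s) (W s) * Z' + (derivative q).evalEval (Z s) (W s) * W') s := by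
  induction q using Polynomial.induction_on' with
  | add p q hp hq =>
    obtain ⟨r₁, h₁⟩ := hp
    obtain ⟨r₂, h₂⟩ := hq
    refine ⟨r₁ + r₂, fun Z W Z' W' s hZ hW => ?_⟩
    simp only [evalEval_add, derivative_add]
    exact ((h₁ Z W Z' W' s hZ hW).add (h₂ Z W Z' W' s hZ hW)).congr_deriv (by ring)
  | monomial n c =>
    refine ⟨monomial n (derivative c), fun Z W Z' W' s hZ hW => ?_⟩
    have h1 := ((c.hasDerivAt (Z s)).comp s hZ).mul (hW.pow n)
    refine (h1.congr_deriv ?_).congr_of_eventuallyEq (Eventually.of_forall fun t => ?_)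
    · simp [evalEval, eval_monomial, derivative_monomial]
      ring
    · simp [evalEval, eval_monomial]

theorem curveWM_hasDerivAt (M : ℕ) {L : ℂ → ℂ} (hL : AnalyticAt ℂ L 0) :
    ∀ᶠ s in 𝓝 0, HasDerivAt (curveWM M L)
      (Complex.I * (((2 * M : ℕ) : ℂ) * s ^ (2 * M - 1)) +
        2 * M * Complex.I * (s ^ (2 * M) * deriv L s)) s := by
  have hg : AnalyticAt ℂ (fun x => x ^ (2 * M) * deriv L x) 0 :=
    (analyticAt_id.pow _).mul hL.deriv
  obtain ⟨r, hr, hball⟩ := Metric.eventually_nhds_iff_ball.1 hg.eventually_analyticAt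
  obtain ⟨G, hG⟩ := DifferentiableOn.isExactOn_ball
    (fun x hx => (hball x hx).differentiableAt.differentiableWithinAt)
  have hint : ∀ s ∈ Metric.ball (0 : ℂ) r,
      ∫ t in (0 : ℝ)..1, s * (((t : ℂ) * s) ^ (2 * M) * deriv L ((t : ℂ) * s)) = G s - G 0 := by
    intro s hs
    have hmem : ∀ t ∈ Set.uIcc (0 : ℝ) 1, (t : ℂ) * s ∈ Metric.ball (0 : ℂ) r := by
      intro t ht
      rw [Set.uIcc_of_le zero_le_one] at ht
      rw [mem_ball_zero_iff] at hs ⊢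
      rw [norm_mul, Complex.norm_real, Real.norm_of_nonneg ht.1]
      exact (mul_le_of_le_one_left (norm_nonneg _) ht.2).trans_lt hs
    have hline : ∀ t : ℝ, HasDerivAt (fun t : ℝ => (t : ℂ) * s) s t := fun t => by
      simpa using (Complex.ofRealCLM.hasDerivAt (x := t)).mul_const s
    rw [intervalIntegral.integral_eq_sub_of_hasDerivAt (f := fun t : ℝ => G ((t : ℂ) * s))]
    · simp
    · intro t ht
      rw [mul_comm]
      exact (hG _ (hmem t ht)).comp t (hline t)
    · refine ContinuousOn.intervalIntegrable (continuousOn_const.mul fun t ht => ?_)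
      exact ((hball _ (hmem t ht)).continuousAt.comp
        (f := fun t : ℝ => (t : ℂ) * s) (hline t).continuousAt).continuousWithinAt
  filter_upwards [Metric.ball_mem_nhds (0 : ℂ) hr] with s hs
  have h1 : HasDerivAt (fun s => Complex.I * s ^ (2 * M) + 2 * (M : ℂ) * Complex.I * (G s - G 0))
      (Complex.I * (((2 * M : ℕ) : ℂ) * s ^ (2 * M - 1)) +
        2 * M * Complex.I * (s ^ (2 * M) * deriv L s)) s :=
    ((hasDerivAt_pow (2 * M) s).const_mul _).add (((hG s hs).sub_const _).const_mul _)
  refine h1.congr_of_eventuallyEq ?_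
  filter_upwards [Metric.isOpen_ball.mem_nhds hs] with t ht
  rw [curveWM, hint t ht]

theorem curveWM_analyticAt (M : ℕ) {L : ℂ → ℂ} (hL : AnalyticAt ℂ L 0) :
    AnalyticAt ℂ (curveWM M L) 0 :=
  Complex.analyticAt_iff_eventually_differentiableAt.2
    ((curveWM_hasDerivAt M hL).mono fun _ h => h.differentiableAt)

/-- Along the curve, a polynomial relation `q(Z, W) = 0` can be differentiated and solved for
`s ^ (2 * M)`. -/
theorem exists_relation_of_evalEval_eq_zero {M : ℕ} (hM : 0 < M) {L : ℂ → ℂ}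
    (hL : AnalyticAt ℂ L 0) (q : ℂ[X][X])
    (hq : ∀ᶠ s in 𝓝 0,
      q.evalEval (s ^ M * Complex.exp (M * L s)) (curveWM M L s) = 0) :
    ∃ r : ℂ[X][X], ∀ᶠ s in 𝓝 0,
      r.evalEval (s ^ M * Complex.exp (M * L s)) (curveWM M L s) +
      (C (C (2 * Complex.I)) * derivative q).evalEval
        (s ^ M * Complex.exp (M * L s)) (curveWM M L s) * s ^ (2 * M) = 0 := by
  obtain ⟨r, hr⟩ := exists_hasDerivAt_evalEval q
  refine ⟨r * C X, ?_⟩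
  have hu : ∀ᶠ s in 𝓝 (0 : ℂ), 1 + s * deriv L s ≠ 0 := by
    have : ContinuousAt (fun s => 1 + s * deriv L s) 0 :=
      continuousAt_const.add (continuousAt_id.mul hL.deriv.continuousAt)
    exact this.eventually_ne (by simp)
  filter_upwards [hq.eventually_nhds, curveWM_hasDerivAt M hL, hL.eventually_analyticAt, hu]
    with s hqs hW hLs hus
  have hZ : HasDerivAt (fun s => s ^ M * Complex.exp (M * L s))
      (M * s ^ (M - 1) * Complex.exp (M * L s) +
        s ^ M * (Complex.exp (M * L s) * (M * deriv L s))) s :=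
    (hasDerivAt_pow M s).mul ((hLs.differentiableAt.hasDerivAt.const_mul (M : ℂ)).cexp)
  have h0 := (hr _ _ _ _ s hZ hW).unique
    ((hasDerivAt_const s (0 : ℂ)).congr_of_eventuallyEq hqs)
  have hM0 : (M : ℂ) ≠ 0 := by exact_mod_cast hM.ne'
  have e1 : s * s ^ (M - 1) = s ^ M := by rw [← pow_succ', Nat.sub_add_cancel hM]
  have e2 : s * s ^ (2 * M - 1) = s ^ (2 * M) := by
    rw [← pow_succ', Nat.sub_add_cancel (by omega)]
  simp only [evalEval_mul, evalEval_C, eval_X, eval_C]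
  refine mul_left_cancel₀ (mul_ne_zero hM0 hus) ?_
  push_cast at h0
  generalize r.evalEval _ _ = R at h0 ⊢
  generalize (derivative q).evalEval _ _ = Q at h0 ⊢
  generalize Complex.exp _ = E at h0 ⊢
  linear_combination s * h0 - R * M * E * e1 - Q * Complex.I * 2 * M * e2

/-- Let `L` be analytic near `0 ∈ ℂ` with `L(0) = 0`, and let
`γ(s) = (s^M e^{M L(s)}, i s^{2M} + 2Mi ∫_{[0,s]} x^{2M} L′(x) dx)`. If some
nonconstant irreducible polynomial `p ∈ ℂ[z,w]` vanishes identically along `γ`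
near `0`, then `f(s) = e^{L(s)}` is algebraic: some nonzero polynomial
`P ∈ ℂ[s,y]` satisfies `P(s, e^{L(s)}) = 0` for all `s` near `0`. -/
theorem statement18 (M : ℕ) (hM : 0 < M) (L : ℂ → ℂ)
    (hL : AnalyticAt ℂ L 0) (hL0 : L 0 = 0)
    (p : MvPolynomial (Fin 2) ℂ) (hirr : Irreducible p) (hnc : p.totalDegree ≠ 0)
    (hzero : ∃ δ : ℝ, 0 < δ ∧ ∀ s : ℂ, ‖s‖ < δ →
      MvPolynomial.eval ![s ^ M * Complex.exp ((M : ℂ) * L s), curveWM M L s] p = 0) :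
    ∃ P : MvPolynomial (Fin 2) ℂ, P ≠ 0 ∧
      ∃ ε : ℝ, 0 < ε ∧ ∀ s : ℂ, ‖s‖ < ε →
        MvPolynomial.eval ![s, Complex.exp (L s)] P = 0 := by
  have hZan : AnalyticAt ℂ (fun s => s ^ M * Complex.exp (M * L s)) 0 :=
    (analyticAt_id.pow M).mul (analyticAt_const.mul hL).cexp
  have hWan := curveWM_analyticAt M hL
  have hid : AnalyticAt ℂ (fun s : ℂ => s) 0 := analyticAt_id
  have hfan : AnalyticAt ℂ (fun s => Complex.exp (L s)) 0 := hL.cexp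
  have hx : Transcendental ℂ (AnalyticGerm.of hid) := by
    refine AnalyticGerm.transcendental_of hid fun h => ?_
    obtain ⟨s, h1, h2⟩ := ((h.filter_mono nhdsWithin_le_nhds).and
      (self_mem_nhdsWithin (a := (0 : ℂ)) (s := {0}ᶜ))).exists
    exact h2 h1
  have hz : Transcendental ℂ (AnalyticGerm.of hZan) := by
    refine AnalyticGerm.transcendental_of hZan fun h => ?_
    obtain ⟨s, h1, h2⟩ := ((h.filter_mono nhdsWithin_le_nhds).and
      (self_mem_nhdsWithin (a := (0 : ℂ)) (s := {0}ᶜ))).exists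
    rw [zero_pow hM.ne', zero_mul] at h1
    exact mul_ne_zero (pow_ne_zero M h2) (Complex.exp_ne_zero _) h1
  have hzw : ¬ AlgebraicIndependent ℂ ![AnalyticGerm.of hZan, AnalyticGerm.of hWan] := by
    intro hind
    refine hirr.ne_zero (algebraicIndependent_iff.1 hind p ?_)
    rw [AnalyticGerm.aeval_of_eq_zero_iff]
    obtain ⟨δ, hδ, h⟩ := hzero
    filter_upwards [Metric.ball_mem_nhds (0 : ℂ) hδ] with s hs
    exact h s (mem_ball_zero_iff.1 hs)
  have hfac : AnalyticGerm.of hid ^ M * AnalyticGerm.of hfan ^ M = AnalyticGerm.of hZan := by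
    rw [AnalyticGerm.of_pow, AnalyticGerm.of_pow, AnalyticGerm.of_mul, AnalyticGerm.of_eq_of_iff]
    exact Eventually.of_forall fun s => by simp [Complex.exp_nat_mul]
  have hind : ¬ AlgebraicIndependent ℂ ![AnalyticGerm.of hid, AnalyticGerm.of hfan] := by
    refine not_algebraicIndependent_of_forall_relation (N := 2 * M) (by omega) hM
      (mul_ne_zero two_ne_zero Complex.I_ne_zero) hx hz hzw (fun q hq => ?_) hfac
    rw [AnalyticGerm.aevalAeval_of, AnalyticGerm.of_eq_zero_iff] at hq
    obtain ⟨r, hr⟩ := exists_relation_of_evalEval_eq_zero hM hL q hq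
    refine ⟨r, ?_⟩
    rw [AnalyticGerm.aevalAeval_of, AnalyticGerm.aevalAeval_of, AnalyticGerm.of_pow,
      AnalyticGerm.of_mul, AnalyticGerm.of_add, AnalyticGerm.of_eq_zero_iff]
    exact hr
  rw [algebraicIndependent_iff] at hind
  push Not at hind
  obtain ⟨P, hP, hP0⟩ := hind
  rw [AnalyticGerm.aeval_of_eq_zero_iff] at hP
  obtain ⟨ε, hε, h⟩ := Metric.eventually_nhds_iff_ball.1 hP
  exact ⟨P, hP0, ε, hε, fun s hs => h s (mem_ball_zero_iff.2 hs)⟩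
end

section
/- The polynomial p(z,w) = w + w² − z² has no zeros in the Siegel half-space U₂: for all (z,w) ∈ ℂ² with Im w > |z|², one has w + w² ≠ z². Moreover, p has infinitely many zeros on the boundary ∂U₂ = {(z,w) ∈ ℂ² : Im w = |z|²}. (The key inequality is that |w² + w|² ≥ (Im w)² for all w ∈ ℂ, with equality exactly when |w + 1/2| = 1/2.) -/
theorem norm_sq_add_self_sq (w : ℂ) :
    ‖w ^ 2 + w‖ ^ 2 = (‖w + 1 / 2‖ ^ 2 - 1 / 4) ^ 2 + w.im ^ 2 := by
  simp only [← Complex.normSq_eq_norm_sq, Complex.normSq_apply, Complex.add_re, Complex.add_im,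
    pow_two w, Complex.mul_re, Complex.mul_im, Complex.div_ofNat_re, Complex.div_ofNat_im,
    Complex.one_re, Complex.one_im]
  ring

theorem im_sq_le_norm_sq_add_self (w : ℂ) : w.im ^ 2 ≤ ‖w ^ 2 + w‖ ^ 2 := by
  rw [norm_sq_add_self_sq]
  exact le_add_of_nonneg_left (sq_nonneg _)

theorem norm_sq_add_self_eq_im_sq_iff (w : ℂ) :
    ‖w ^ 2 + w‖ ^ 2 = w.im ^ 2 ↔ ‖w + 1 / 2‖ = 1 / 2 := by
  rw [norm_sq_add_self_sq, add_eq_right, sq_eq_zero_iff, sub_eq_zero,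
    show (1 / 4 : ℝ) = (1 / 2) ^ 2 by norm_num]
  exact sq_eq_sq₀ (norm_nonneg _) (by norm_num)

theorem exists_boundary_zero_of_re_mem_Icc {x : ℝ} (hx : x ∈ Set.Icc (-1) 0) :
    ∃ z w : ℂ, w.re = x ∧ w.im = ‖z‖ ^ 2 ∧ w + w ^ 2 = z ^ 2 := by
  have hnonneg : 0 ≤ -x ^ 2 - x := by nlinarith [hx.1, hx.2]
  let w : ℂ := ⟨x, √(-x ^ 2 - x)⟩
  have hcircle : ‖w + 1 / 2‖ ^ 2 = 1 / 4 := by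
    simp only [w, ← Complex.normSq_eq_norm_sq, Complex.normSq_apply, Complex.add_re,
      Complex.add_im, Complex.div_ofNat_re, Complex.div_ofNat_im, Complex.one_re, Complex.one_im]
    nlinarith [Real.sq_sqrt hnonneg]
  have hnorm : ‖w ^ 2 + w‖ = w.im := by
    refine (sq_eq_sq₀ (norm_nonneg _) (Real.sqrt_nonneg _)).mp ?_
    rw [norm_sq_add_self_sq, hcircle]
    ring
  obtain ⟨z, hz⟩ := IsAlgClosed.exists_pow_nat_eq (w ^ 2 + w) two_pos
  exact ⟨z, w, rfl, by rw [← norm_pow, hz, hnorm], by rw [hz, add_comm]⟩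

/-- The polynomial `p(z,w) = w + w² − z²` has no zeros in the Siegel
half-space `U₂ = {(z,w) : Im w > |z|²}`, yet has infinitely many zeros on the
boundary `∂U₂ = {(z,w) : Im w = |z|²}`. The key inequality is
`|w² + w|² ≥ (Im w)²` for all `w ∈ ℂ`, with equality exactly when `|w + 1/2| = 1/2`. -/
theorem statement19 :
    (∀ z w : ℂ, ‖z‖ ^ 2 < w.im → w + w ^ 2 ≠ z ^ 2) ∧
    Set.Infinite {zw : ℂ × ℂ | zw.2.im = ‖zw.1‖ ^ 2 ∧ zw.2 + zw.2 ^ 2 = zw.1 ^ 2} ∧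
    (∀ w : ℂ, (w.im) ^ 2 ≤ ‖w ^ 2 + w‖ ^ 2 ∧
      (‖w ^ 2 + w‖ ^ 2 = (w.im) ^ 2 ↔ ‖w + 1 / 2‖ = 1 / 2)) := by
  refine ⟨fun z w hzw h => ?_, ?_, fun w =>
    ⟨im_sq_le_norm_sq_add_self w, norm_sq_add_self_eq_im_sq_iff w⟩⟩
  · have hle := im_sq_le_norm_sq_add_self w
    rw [add_comm, h, norm_pow] at hle
    exact absurd hle (not_le.mpr (pow_lt_pow_left₀ hzw (sq_nonneg _) two_ne_zero))
  · refine Set.Infinite.of_image (fun zw : ℂ × ℂ => zw.2.re)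
      ((Set.Icc_infinite (show (-1 : ℝ) < 0 by norm_num)).mono fun x hx => ?_)
    obtain ⟨z, w, hre, him, hzero⟩ := exists_boundary_zero_of_re_mem_Icc hx
    exact ⟨(z, w), ⟨him, hzero⟩, hre⟩
end
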